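/- There exist universal constants C and c > 0 such that for all sufficiently large n the following holds with k_out = ⌈(log₂ n)^C⌉: there exists a function f : {0,1}^n × {0,1}^n → {0,1}^m with m ≥ k_out^c such that for every pair of independent (n,k_out)-sources X and Y, there exist subsources X' of X and Y' of Y, each of min-entropy at least k_out^c, such that f(X',Y') is 2^{-k_out^c}-close to the uniform distribution on {0,1}^m (a two-source sub-extractor for outer-entropy k_out and inner-entropy k_out^c with error 2^{-k_out^c}). -/

import Mathlib

/-- Bit strings of length `n`. -/
abbrev BitStr (n : ℕ) := Fin n → Bool

/-- The probability that a sample from `X` lands in the set `A`. -/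
noncomputable def prSet {α : Type*} [Fintype α] (X : α → ℝ) (A : Set α) : ℝ :=
  ∑ x, A.indicator X x

/-- `X` is a (finitely supported) probability distribution. -/
def IsDist {α : Type*} [Fintype α] (X : α → ℝ) : Prop :=
  (∀ x, 0 ≤ X x) ∧ ∑ x, X x = 1

/-- `X` has min-entropy at least `k`, i.e. every point has probability at most `2 ^ (-k)`. -/
def MinEntropyGe {α : Type*} [Fintype α] (X : α → ℝ) (k : ℝ) : Prop :=
  ∀ x, X x ≤ (2 : ℝ) ^ (-k)

/-- The distribution of `X` conditioned on the event `A`. -/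
noncomputable def CondOn {α : Type*} [Fintype α] (X : α → ℝ) (A : Set α) : α → ℝ :=
  fun x => A.indicator X x / prSet X A

/-- `X'` is a deficiency-`d` subsource of `X`. -/
def IsSubsource {α : Type*} [Fintype α] (X' X : α → ℝ) (d : ℝ) : Prop :=
  ∃ A : Set α, (2 : ℝ) ^ (-d) ≤ prSet X A ∧ X' = CondOn X A

/-- `X'` is a subsource of `X` (conditioning on some positive-probability event). -/
def IsSubsourceAny {α : Type*} [Fintype α] (X' X : α → ℝ) : Prop :=
  ∃ A : Set α, 0 < prSet X A ∧ X' = CondOn X A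

/-- `X` is `ε`-close to `Y` in statistical distance. -/
def CloseTo {α : Type*} [Fintype α] (X Y : α → ℝ) (ε : ℝ) : Prop :=
  ∀ A : Set α, |prSet X A - prSet Y A| ≤ ε

/-- The uniform distribution on `α`. -/
noncomputable def uniformDist (α : Type*) [Fintype α] : α → ℝ :=
  fun _ => 1 / Fintype.card α

/-- The joint distribution of independent samples from `X` and `Y`. -/
noncomputable def jointDist {α β : Type*} (X : α → ℝ) (Y : β → ℝ) : α × β → ℝ :=
  fun p => X p.1 * Y p.2

/-- The distribution of `f x` where `x ~ X`. -/
noncomputable def pushDist {α β : Type*} [Fintype α] [DecidableEq β]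
    (f : α → β) (X : α → ℝ) : β → ℝ :=
  fun b => ∑ x, if f x = b then X x else 0

/-- The distribution of `f x y` where `x ~ X` and `y ~ Y` independently. -/
noncomputable def jointPush {α β γ : Type*} [Fintype α] [Fintype β] [DecidableEq γ]
    (f : α → β → γ) (X : α → ℝ) (Y : β → ℝ) : γ → ℝ :=
  pushDist (fun p => f p.1 p.2) (jointDist X Y)

/-- The left half (length-`n/2` prefix) of a bit string. -/
def leftHalf {n : ℕ} (x : BitStr n) : BitStr (n / 2) :=
  fun i => x ⟨i.1, by have := i.isLt; omega⟩

/-- The right half (length-`n/2` suffix, for even `n`) of a bit string. -/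
def rightHalf {n : ℕ} (x : BitStr n) : BitStr (n / 2) :=
  fun i => x ⟨n / 2 + i.1, by have := i.isLt; omega⟩

/-- The distribution of the left half of a sample from `X`. -/
noncomputable def margL {n : ℕ} (X : BitStr n → ℝ) : BitStr (n / 2) → ℝ :=
  pushDist leftHalf X

/-- The distribution of the right half of a sample from `X`. -/
noncomputable def margR {n : ℕ} (X : BitStr n → ℝ) : BitStr (n / 2) → ℝ :=
  pushDist rightHalf X

/-- The probability that the left half equals `a` and the right half equals `r`. -/
noncomputable def jointLR {n : ℕ} (X : BitStr n → ℝ) (a r : BitStr (n / 2)) : ℝ :=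
  ∑ x, if leftHalf x = a ∧ rightHalf x = r then X x else 0

/-- `X` is a `b`-block-source: its left half has min-entropy at least `b`, and
conditioned on any value of the left half in its support, the right half has
min-entropy at least `b`. -/
def IsBlockSource {n : ℕ} (X : BitStr n → ℝ) (b : ℝ) : Prop :=
  MinEntropyGe (margL X) b ∧
  ∀ a, 0 < margL X a → ∀ r, jointLR X a r ≤ (2 : ℝ) ^ (-b) * margL X a

/-- The distribution of the right half conditioned on the left half being `a`. -/
noncomputable def condRight {n : ℕ} (X : BitStr n → ℝ) (a : BitStr (n / 2)) :
    BitStr (n / 2) → ℝ :=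
  fun r => jointLR X a r / margL X a

/-- The min-entropy of `X`: `-log₂` of the largest point probability. -/
noncomputable def minEntropyVal {α : Type*} [Fintype α] [Nonempty α] (X : α → ℝ) : ℝ :=
  - Real.logb 2 (⨆ x, X x)

/-- An independent set in a simple graph: a set of pairwise non-adjacent vertices. -/
def SimpleGraph.IsIndepSet' {V : Type*} (G : SimpleGraph V) (s : Set V) : Prop :=
  s.Pairwise (fun a b => ¬ G.Adj a b)


open Finset in
/-- A linear functional on the polytope of distributions bounded by `1/K` is at most its value
on a flat distribution. -/
lemma greedy_flat {α : Type*} [Fintype α] [DecidableEq α] (X g : α → ℝ) (K : ℕ) (hK : 0 < K)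
    (h0 : ∀ x, 0 ≤ X x) (h1 : ∑ x, X x = 1) (hX : ∀ x, X x ≤ 1 / (K : ℝ)) :
    ∃ S ∈ powersetCard K (univ : Finset α), ∑ x, X x * g x ≤ (1 / (K : ℝ)) * ∑ x ∈ S, g x := by
  have hKr : (0 : ℝ) < K := by exact_mod_cast hK
  have hcard : K ≤ (univ : Finset α).card := by
    have h2 : (1 : ℝ) ≤ (univ : Finset α).card * (1 / (K : ℝ)) := by
      calc (1 : ℝ) = ∑ x, X x := h1.symm
        _ ≤ ∑ _x : α, 1 / (K : ℝ) := sum_le_sum fun x _ => hX x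
        _ = _ := by rw [sum_const, nsmul_eq_mul]
    rw [mul_one_div, le_div_iff₀ hKr, one_mul] at h2
    exact_mod_cast h2
  obtain ⟨S, hS, hmax⟩ := exists_max_image (powersetCard K (univ : Finset α))
    (fun S => ∑ x ∈ S, g x) (powersetCard_nonempty.2 hcard)
  refine ⟨S, hS, ?_⟩
  have hSc : S.card = K := (mem_powersetCard.1 hS).2
  have hSne : S.Nonempty := card_pos.1 (by omega)
  have hswap : ∀ s ∈ S, ∀ t ∉ S, g t ≤ g s := by
    intro s hs t ht
    have ht' : t ∉ S.erase s := fun h => ht (mem_of_mem_erase h)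
    have := hmax (insert t (S.erase s)) (by
      rw [mem_powersetCard]
      refine ⟨subset_univ _, ?_⟩
      rw [card_insert_of_notMem ht', card_erase_of_mem hs]
      omega)
    rw [sum_insert ht', ← add_sum_erase S g hs] at this
    linarith
  obtain ⟨s, hs, hmin⟩ := exists_min_image S g hSne
  have key : ∑ x, X x * (g x - g s) ≤ ∑ x ∈ S, (1 / (K : ℝ)) * (g x - g s) := by
    rw [← sum_add_sum_compl S]
    have e1 : ∑ x ∈ S, X x * (g x - g s) ≤ ∑ x ∈ S, (1 / (K : ℝ)) * (g x - g s) :=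
      sum_le_sum fun x hx => mul_le_mul_of_nonneg_right (hX x) (by linarith [hmin x hx])
    have e2 : ∑ x ∈ Sᶜ, X x * (g x - g s) ≤ 0 :=
      sum_nonpos fun x hx => mul_nonpos_of_nonneg_of_nonpos (h0 x)
        (by linarith [hswap s hs x (mem_compl.1 hx)])
    linarith
  simp only [mul_sub, sum_sub_distrib, ← sum_mul, ← mul_sum, h1, sum_const, hSc,
    nsmul_eq_mul] at key
  have : 1 / (K : ℝ) * (K * g s) = g s := by field_simp
  linarith

/-- The centered indicator of `A`. -/
noncomputable def cInd {B : Type*} [Fintype B] [DecidableEq B] (A : Finset B) (b : B) : ℝ :=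
  (if b ∈ A then 1 else 0) - (A.card : ℝ) / Fintype.card B

open Finset in
lemma cInd_sum {B : Type*} [Fintype B] [Nonempty B] [DecidableEq B] (A : Finset B) :
    ∑ b, cInd A b = 0 := by
  have : (Fintype.card B : ℝ) ≠ 0 := by exact_mod_cast Fintype.card_ne_zero
  simp [cInd, sum_sub_distrib]
  field_simp
  simp

open Finset in
lemma cInd_abs {B : Type*} [Fintype B] [Nonempty B] [DecidableEq B] (A : Finset B) (b : B) :
    |cInd A b| ≤ 1 := by
  have h0 : (0 : ℝ) < Fintype.card B := by exact_mod_cast Fintype.card_pos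
  have h1 : (A.card : ℝ) / Fintype.card B ≤ 1 := by
    rw [div_le_one h0]; exact_mod_cast card_le_univ A
  have h2 : 0 ≤ (A.card : ℝ) / Fintype.card B := by positivity
  unfold cInd
  rw [abs_le]
  split_ifs <;> constructor <;> linarith

open Finset in
lemma mgf_bound {B : Type*} [Fintype B] [Nonempty B] [DecidableEq B] (A : Finset B) (l : ℝ)
    (hl0 : 0 ≤ l) (hl : l ≤ 1) :
    ∑ b, Real.exp (l * cInd A b) ≤ Fintype.card B * Real.exp (l ^ 2) := by
  have h : ∀ b, Real.exp (l * cInd A b) ≤ 1 + l * cInd A b + l ^ 2 := by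
    intro b
    have ha := cInd_abs A b
    have hx : |l * cInd A b| ≤ 1 := by
      rw [abs_mul, abs_of_nonneg hl0]; nlinarith [abs_nonneg (cInd A b)]
    have h1 := (abs_le.1 (Real.abs_exp_sub_one_sub_id_le hx)).2
    have h2 : (cInd A b) ^ 2 ≤ 1 := by rwa [sq_le_one_iff_abs_le_one]
    nlinarith [sq_nonneg l]
  calc ∑ b, Real.exp (l * cInd A b) ≤ ∑ b, (1 + l * cInd A b + l ^ 2) := sum_le_sum fun b _ => h b
    _ = Fintype.card B * (l ^ 2 + 1) := by
      simp only [sum_add_distrib, ← mul_sum, cInd_sum, sum_const, nsmul_eq_mul, card_univ]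
      ring
    _ ≤ _ := by gcongr; exact Real.add_one_le_exp _

open Finset in
lemma exists_good {α B : Type*} [Fintype α] [DecidableEq α] [Fintype B] [Nonempty B]
    [DecidableEq B] (K : ℕ) (e : ℝ) (he0 : 0 ≤ e) (he : e ≤ 1)
    (hbig : ((Fintype.card α : ℝ) ^ K) ^ 2 * 2 ^ (Fintype.card B)
      < Real.exp (e ^ 2 * (K : ℝ) ^ 2 / 4)) :
    ∃ f : α × α → B, ∀ S ∈ powersetCard K (univ : Finset α),
      ∀ T ∈ powersetCard K (univ : Finset α), ∀ A : Finset B,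
      ∑ p ∈ S ×ˢ T, cInd A (f p) ≤ e * (K : ℝ) ^ 2 := by
  by_contra! hbad
  set P := powersetCard K (univ : Finset α) with hP
  set I := (P ×ˢ P) ×ˢ (univ : Finset (Finset B)) with hI
  let W : (Finset α × Finset α) × Finset B → (α × α → B) → ℝ := fun i f =>
    Real.exp (e / 2 * (∑ p ∈ i.1.1 ×ˢ i.1.2, cInd i.2 (f p)) - e / 2 * (e * (K : ℝ) ^ 2))
  have hlow : ∀ f, 1 ≤ ∑ i ∈ I, W i f := by
    intro f
    obtain ⟨S, hS, T, hT, A, h⟩ := hbad f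
    have hi : ((S, T), A) ∈ I := by simp [hI, hS, hT]
    refine le_trans ?_ (single_le_sum (f := fun i => W i f) (fun i _ => (Real.exp_pos _).le) hi)
    apply Real.one_le_exp
    have : 0 ≤ e / 2 := by linarith
    have := mul_le_mul_of_nonneg_left h.le this
    simp only
    linarith
  have hup : ∀ i ∈ I, ∑ f, W i f ≤
      Fintype.card (α × α → B) * Real.exp (-(e ^ 2 * (K : ℝ) ^ 2 / 4)) := by
    rintro ⟨⟨S, T⟩, A⟩ hi
    simp only [hI, hP, mem_product, mem_powersetCard, mem_univ, and_true, subset_univ,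
      true_and] at hi
    obtain ⟨hS, hT⟩ := hi
    have h1 : ∀ f, W ((S, T), A) f = Real.exp (- (e / 2 * (e * (K : ℝ) ^ 2))) *
        ∏ p : α × α, (if p ∈ S ×ˢ T then Real.exp (e / 2 * cInd A (f p)) else 1) := by
      intro f
      rw [prod_ite_mem, univ_inter, ← Real.exp_sum, ← Real.exp_add, ← mul_sum]
      simp only [W]
      congr 1; ring
    simp only [h1, ← mul_sum]
    have h2 := (Fintype.prod_sum (fun (p : α × α) (b : B) =>
      if p ∈ S ×ˢ T then Real.exp (e / 2 * cInd A b) else 1)).symm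
    rw [h2]
    have h3 : ∏ p : α × α, ∑ b, (if p ∈ S ×ˢ T then Real.exp (e / 2 * cInd A b) else 1)
        ≤ ∏ p : α × α, (Fintype.card B *
          (if p ∈ S ×ˢ T then Real.exp ((e / 2) ^ 2) else 1)) := by
      apply prod_le_prod
      · intro p _; apply sum_nonneg; intro b _; split_ifs <;> positivity
      · intro p _
        split_ifs
        · exact mgf_bound A _ (by linarith) (by linarith)
        · simp
    have h4 : ∏ p : α × α, ((Fintype.card B : ℝ) *
          (if p ∈ S ×ˢ T then Real.exp ((e / 2) ^ 2) else 1)) =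
        Fintype.card (α × α → B) * Real.exp ((K : ℝ) ^ 2 * (e / 2) ^ 2) := by
      rw [prod_mul_distrib, prod_const, card_univ, prod_ite_mem, univ_inter, prod_const,
        card_product, hS, hT, ← Real.exp_nat_mul, Fintype.card_fun]
      push_cast
      ring_nf
    rw [h4] at h3
    calc _ ≤ _ := mul_le_mul_of_nonneg_left h3 (Real.exp_pos _).le
      _ = Fintype.card (α × α → B) * (Real.exp (- (e / 2 * (e * (K : ℝ) ^ 2))) *
          Real.exp ((K : ℝ) ^ 2 * (e / 2) ^ 2)) := by ring
      _ ≤ _ := by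
        rw [← Real.exp_add]
        apply le_of_eq; congr 2; ring
  have hF : (0 : ℝ) < Fintype.card (α × α → B) := by exact_mod_cast Fintype.card_pos
  have hIc : (I.card : ℝ) ≤ ((Fintype.card α : ℝ) ^ K) ^ 2 * 2 ^ (Fintype.card B) := by
    have : P.card ≤ (Fintype.card α) ^ K := by
      rw [hP, card_powersetCard, card_univ]; exact Nat.choose_le_pow _ _
    have h2 : I.card ≤ ((Fintype.card α) ^ K) ^ 2 * 2 ^ (Fintype.card B) := by
      rw [hI, card_product, card_product, card_univ, Fintype.card_finset, sq]
      gcongr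
    exact_mod_cast h2
  have h5 : (Fintype.card (α × α → B) : ℝ) ≤
      I.card * (Fintype.card (α × α → B) * Real.exp (-(e ^ 2 * (K : ℝ) ^ 2 / 4))) := by
    calc (Fintype.card (α × α → B) : ℝ) = ∑ _f : α × α → B, (1 : ℝ) := by simp
      _ ≤ ∑ f, ∑ i ∈ I, W i f := sum_le_sum fun f _ => hlow f
      _ = ∑ i ∈ I, ∑ f, W i f := sum_comm
      _ ≤ _ := by
        rw [← nsmul_eq_mul]; exact sum_le_card_nsmul _ _ _ hup
  rw [Real.exp_neg] at h5
  have hE := Real.exp_pos (e ^ 2 * (K : ℝ) ^ 2 / 4)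
  have h6 : (I.card : ℝ) < Real.exp (e ^ 2 * (K : ℝ) ^ 2 / 4) := lt_of_le_of_lt hIc hbig
  have h7 : (I.card : ℝ) * (Fintype.card (α × α → B) *
      (Real.exp (e ^ 2 * (K : ℝ) ^ 2 / 4))⁻¹) < Fintype.card (α × α → B) := by
    rw [← mul_assoc, ← div_eq_mul_inv, div_lt_iff₀ hE, mul_comm]
    exact mul_lt_mul_of_pos_left h6 hF
  linarith

open Finset in
lemma good_general {α B : Type*} [Fintype α] [DecidableEq α] [Fintype B] [Nonempty B]
    [DecidableEq B] (K : ℕ) (hK : 0 < K) (e : ℝ) (f : α × α → B)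
    (hf : ∀ S ∈ powersetCard K (univ : Finset α),
      ∀ T ∈ powersetCard K (univ : Finset α), ∀ A : Finset B,
      ∑ p ∈ S ×ˢ T, cInd A (f p) ≤ e * (K : ℝ) ^ 2)
    (X Y : α → ℝ) (hX0 : ∀ x, 0 ≤ X x) (hX1 : ∑ x, X x = 1) (hX : ∀ x, X x ≤ 1 / (K : ℝ))
    (hY0 : ∀ x, 0 ≤ Y x) (hY1 : ∑ x, Y x = 1) (hY : ∀ x, Y x ≤ 1 / (K : ℝ)) (A : Finset B) :
    ∑ p : α × α, X p.1 * Y p.2 * cInd A (f p) ≤ e := by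
  have hKr : (0 : ℝ) < K := by exact_mod_cast hK
  obtain ⟨S, hS, h1⟩ := greedy_flat X (fun x => ∑ y, Y y * cInd A (f (x, y))) K hK hX0 hX1 hX
  obtain ⟨T, hT, h2⟩ := greedy_flat Y (fun y => ∑ x ∈ S, cInd A (f (x, y))) K hK hY0 hY1 hY
  have h3 := hf S hS T hT A
  rw [sum_product, sum_comm] at h3
  have h4 : ∑ x ∈ S, ∑ y, Y y * cInd A (f (x, y)) = ∑ y, Y y * ∑ x ∈ S, cInd A (f (x, y)) := by
    rw [sum_comm]; simp only [mul_sum]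
  have h5 : ∑ p : α × α, X p.1 * Y p.2 * cInd A (f p)
      = ∑ x, X x * ∑ y, Y y * cInd A (f (x, y)) := by
    rw [Fintype.sum_prod_type]; simp only [mul_sum, mul_assoc]
  rw [h5]
  refine h1.trans ?_
  rw [h4]
  have hi : 0 ≤ 1 / (K : ℝ) := by positivity
  calc _ ≤ 1 / (K : ℝ) * (1 / (K : ℝ) * (e * (K : ℝ) ^ 2)) :=
        mul_le_mul_of_nonneg_left (h2.trans (mul_le_mul_of_nonneg_left h3 hi)) hi
    _ = e := by field_simp

open Finset in
lemma cInd_compl {B : Type*} [Fintype B] [Nonempty B] [DecidableEq B] (A : Finset B) (b : B) :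
    cInd Aᶜ b = - cInd A b := by
  have h0 : (Fintype.card B : ℝ) ≠ 0 := by exact_mod_cast Fintype.card_ne_zero
  unfold cInd
  rw [card_compl, Nat.cast_sub (card_le_univ A), sub_div, div_self h0]
  by_cases h : b ∈ A <;> simp [h]

open Finset in
lemma close_of_good {n m : ℕ} (f : BitStr n × BitStr n → BitStr m) (X Y : BitStr n → ℝ)
    (e : ℝ) (hX1 : ∑ x, X x = 1) (hY1 : ∑ x, Y x = 1)
    (h : ∀ A : Finset (BitStr m), ∑ p : BitStr n × BitStr n, X p.1 * Y p.2 * cInd A (f p) ≤ e) :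
    CloseTo (jointPush (fun x y => f (x, y)) X Y) (uniformDist (BitStr m)) e := by
  classical
  intro A
  have key : prSet (jointPush (fun x y => f (x, y)) X Y) A - prSet (uniformDist (BitStr m)) A
      = ∑ p : BitStr n × BitStr n, X p.1 * Y p.2 * cInd A.toFinset (f p) := by
    have e1 : prSet (jointPush (fun x y => f (x, y)) X Y) A
        = ∑ p : BitStr n × BitStr n, X p.1 * Y p.2 * (if f p ∈ A then 1 else 0) := by
      simp only [prSet, jointPush, pushDist, jointDist, Set.indicator_apply]
      have : ∀ b, (if b ∈ A then ∑ p : BitStr n × BitStr n,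
          (if f (p.1, p.2) = b then X p.1 * Y p.2 else 0) else 0) =
          ∑ p : BitStr n × BitStr n,
          (if f p = b then X p.1 * Y p.2 * (if f p ∈ A then 1 else 0) else 0) := by
        intro b
        by_cases hb : b ∈ A
        · rw [if_pos hb]
          refine sum_congr rfl fun p _ => ?_
          by_cases hp : f p = b
          · simp [hp, hb]
          · simp [hp]
        · rw [if_neg hb]
          symm
          refine sum_eq_zero fun p _ => ?_
          by_cases hp : f p = b
          · simp [hp, hb]
          · simp [hp]
      rw [sum_congr rfl fun b _ => this b, sum_comm]
      simp
    have e2 : prSet (uniformDist (BitStr m)) A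
        = (A.toFinset.card : ℝ) / Fintype.card (BitStr m) := by
      simp only [prSet, uniformDist, Set.indicator_apply]
      rw [← sum_filter, sum_const, nsmul_eq_mul, mul_one_div]
      congr 2
      congr 1
      ext b; simp
    have e3 : ∑ p : BitStr n × BitStr n, X p.1 * Y p.2 = 1 := by
      rw [Fintype.sum_prod_type]
      simp only [← mul_sum, hY1, mul_one, hX1]
    simp only [cInd, mul_sub, sum_sub_distrib, ← sum_mul, e3, Set.mem_toFinset]
    rw [e1, e2, one_mul]
  rw [key, abs_le]
  refine ⟨?_, h _⟩
  have := h (A.toFinset)ᶜ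
  simp only [cInd_compl, mul_neg, sum_neg_distrib] at this
  linarith

lemma numeric (n k m : ℕ) (s : ℝ) (hs5 : 5 ≤ s) (hsk : s ^ 2 = k)
    (hn : (n : ℝ) ≤ (2 : ℝ) ^ s) (hm : (m : ℝ) ≤ s + 1) :
    ((Fintype.card (BitStr n) : ℝ) ^ (2 ^ k)) ^ 2 * 2 ^ (Fintype.card (BitStr m))
      < Real.exp (((2 : ℝ) ^ (-s)) ^ 2 * ((2 ^ k : ℕ) : ℝ) ^ 2 / 4) := by
  have hK : ((2 ^ k : ℕ) : ℝ) = (2 : ℝ) ^ (s ^ 2) := by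
    rw [hsk, Real.rpow_natCast]; push_cast; rfl
  have hlhs : ((Fintype.card (BitStr n) : ℝ) ^ (2 ^ k)) ^ 2 * 2 ^ (Fintype.card (BitStr m))
      = (2 : ℝ) ^ (n * 2 ^ k * 2 + 2 ^ m) := by
    simp only [Fintype.card_fun, Fintype.card_bool, Fintype.card_fin]
    push_cast
    rw [← pow_mul, ← pow_mul, ← pow_add, mul_assoc]
  have h2e : (2 : ℝ) ≤ Real.exp 1 := by linarith [Real.add_one_le_exp (1 : ℝ)]
  rw [hlhs]
  refine lt_of_le_of_lt (pow_le_pow_left₀ (by norm_num) h2e _) ?_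
  rw [← Real.exp_nat_mul, Real.exp_lt_exp, mul_one, hK]
  have hrhs : ((2 : ℝ) ^ (-s)) ^ 2 * ((2 : ℝ) ^ (s ^ 2)) ^ 2 / 4
      = (2 : ℝ) ^ (2 * s ^ 2 - 2 * s - 2) := by
    rw [← Real.rpow_mul_natCast (by norm_num), ← Real.rpow_mul_natCast (by norm_num),
      ← Real.rpow_add (by norm_num), show (4 : ℝ) = (2 : ℝ) ^ (2 : ℝ) by norm_num,
      ← Real.rpow_sub (by norm_num)]
    congr 1; push_cast; ring
  rw [hrhs]
  have hm2 : (2 : ℝ) ^ m ≤ (2 : ℝ) ^ (s + s ^ 2 + 1) := by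
    rw [← Real.rpow_natCast]
    exact Real.rpow_le_rpow_of_exponent_le (by norm_num) (by nlinarith)
  have hn2 : (n : ℝ) * (2 : ℝ) ^ (s ^ 2) * 2 ≤ (2 : ℝ) ^ (s + s ^ 2 + 1) := by
    rw [Real.rpow_add (by norm_num), Real.rpow_add (by norm_num), Real.rpow_one]
    gcongr
  push_cast
  have hK' : (2 : ℝ) ^ k = (2 : ℝ) ^ (s ^ 2) := by rw [← hK]; push_cast; rfl
  rw [hK']
  calc _ ≤ (2 : ℝ) ^ (s + s ^ 2 + 1) + (2 : ℝ) ^ (s + s ^ 2 + 1) := add_le_add hn2 hm2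
    _ = (2 : ℝ) ^ (s + s ^ 2 + 1 + 1) := by
      rw [Real.rpow_add_one (by norm_num) (s + s ^ 2 + 1)]; ring
    _ < _ := Real.rpow_lt_rpow_of_exponent_lt (by norm_num) (by nlinarith)

lemma subsource_self {n : ℕ} (X : BitStr n → ℝ) (h : IsDist X) : IsSubsourceAny X X := by
  have : prSet X Set.univ = 1 := by simp [prSet, h.2]
  refine ⟨Set.univ, by rw [this]; norm_num, ?_⟩
  funext x
  simp [CondOn, this]

/-- Two-source sub-extractors for outer-entropy `k_out = ⌈(log₂ n)^C⌉`
and inner-entropy `k_out ^ c`, with `m ≥ k_out ^ c` output bits and error `2 ^ (-k_out ^ c)`. -/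
theorem two_source_sub_extractor :
    ∃ (C : ℕ) (c : ℝ), 0 < C ∧ 0 < c ∧ ∃ N : ℕ, ∀ n : ℕ, N ≤ n →
      ∀ kout : ℕ, kout = ⌈Real.logb 2 n ^ C⌉₊ →
        ∃ (m : ℕ) (f : BitStr n → BitStr n → BitStr m),
          (kout : ℝ) ^ c ≤ (m : ℝ) ∧
          ∀ X Y : BitStr n → ℝ, IsDist X → IsDist Y →
            MinEntropyGe X kout → MinEntropyGe Y kout →
            ∃ X' Y' : BitStr n → ℝ,
              IsSubsourceAny X' X ∧ IsSubsourceAny Y' Y ∧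
              MinEntropyGe X' ((kout : ℝ) ^ c) ∧ MinEntropyGe Y' ((kout : ℝ) ^ c) ∧
              CloseTo (jointPush f X' Y') (uniformDist (BitStr m))
                ((2 : ℝ) ^ (-(kout : ℝ) ^ c)) := by
  refine ⟨2, 1 / 2, by norm_num, by norm_num, 32, ?_⟩
  intro n hn k hk
  have hn0 : (0 : ℝ) < n := by exact_mod_cast (by omega : 0 < n)
  have hlog : 5 ≤ Real.logb 2 n := by
    rw [Real.le_logb_iff_rpow_le (by norm_num) hn0]
    have : (32 : ℝ) ≤ n := by exact_mod_cast hn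
    norm_num; exact hn
  have hle : Real.logb 2 n ^ 2 ≤ k := by rw [hk]; exact Nat.le_ceil _
  set s : ℝ := (k : ℝ) ^ (1 / 2 : ℝ) with hs
  have hs' : s = Real.sqrt k := by rw [hs, Real.sqrt_eq_rpow]
  have hsk : s ^ 2 = k := by rw [hs', Real.sq_sqrt (Nat.cast_nonneg k)]
  have hls : Real.logb 2 n ≤ s := by rw [hs']; exact Real.le_sqrt_of_sq_le hle
  have hs5 : 5 ≤ s := hlog.trans hls
  have hns : (n : ℝ) ≤ (2 : ℝ) ^ s := by
    rwa [← Real.logb_le_iff_le_rpow (by norm_num) hn0]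
  obtain ⟨f, hf⟩ := exists_good (α := BitStr n) (B := BitStr ⌈s⌉₊) (2 ^ k) ((2 : ℝ) ^ (-s))
    (by positivity) (Real.rpow_le_one_of_one_le_of_nonpos (by norm_num) (by linarith))
    (numeric n k ⌈s⌉₊ s hs5 hsk hns (Nat.ceil_lt_add_one (by linarith)).le)
  refine ⟨⌈s⌉₊, fun x y => f (x, y), Nat.le_ceil _, ?_⟩
  intro X Y hX hY hXe hYe
  have hsle : s ≤ k := by rw [← hsk]; nlinarith
  have hmono : (2 : ℝ) ^ (-(k : ℝ)) ≤ (2 : ℝ) ^ (-s) :=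
    Real.rpow_le_rpow_of_exponent_le (by norm_num) (by linarith)
  have hKe : (2 : ℝ) ^ (-(k : ℝ)) = 1 / ((2 ^ k : ℕ) : ℝ) := by
    rw [Real.rpow_neg (by norm_num), Real.rpow_natCast]; push_cast; rw [one_div]
  refine ⟨X, Y, subsource_self X hX, subsource_self Y hY, fun x => (hXe x).trans hmono,
    fun x => (hYe x).trans hmono, ?_⟩
  refine close_of_good f X Y _ hX.2 hY.2 fun A => ?_
  exact good_general (2 ^ k) (by positivity) _ f hf X Y hX.1 hX.2
    (fun x => (hXe x).trans hKe.le) hY.1 hY.2 (fun x => (hYe x).trans hKe.le) A
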